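/- arXiv:1605.09614 — 2 statements merged into one kernel-verified Lean document; each statement's English description precedes it below -/
import Mathlib

section
/- For every decision rule α, the sequence (L_αⁿ 0)_{n≥1} is pointwise nondecreasing and satisfies 0 ≤ L_αⁿ 0(x) ≤ x + b̄ for x ≥ 0; hence the pointwise limit J_α(x) := lim_{n→∞} L_αⁿ 0(x) exists, and it satisfies the fixed point equation L_α J_α = J_α. -/
open MeasureTheory Set Filter Topology

noncomputable section

/-- The constant `b̄ = β ∫ z⁺ ν(dz) / (1-β)`. -/
def bbar (ν : Measure ℝ) (β : ℝ) : ℝ := β * (∫ z, max z 0 ∂ν) / (1 - β)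

/-- The dynamic programming operator `T`. -/
def Tdiv (ν : Measure ℝ) (β γ : ℝ) (v : ℝ → ℝ) (x : ℝ) : ℝ :=
  if 0 ≤ x then
    sSup ((fun a => a - (β / γ) * Real.log
      ((∫ z in Ici (a - x), Real.exp (-(γ * v (x - a + z))) ∂ν)
        + (ν (Iio (a - x))).toReal)) '' Icc 0 x)
  else 0

/-- Membership in the set `S₀`. -/
def memS0 (ν : Measure ℝ) (β : ℝ) (v : ℝ → ℝ) : Prop :=
  (∀ x, 0 ≤ v x) ∧ (∀ x, 0 ≤ x → v x ≤ x + bbar ν β) ∧ (∀ x, x < 0 → v x = 0)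
    ∧ MonotoneOn v (Ici 0) ∧ ContinuousOn v (Ici 0)

/-- Membership in the set `S`. -/
def memS (ν : Measure ℝ) (β : ℝ) (v : ℝ → ℝ) : Prop :=
  (∀ x, 0 ≤ v x) ∧ (∀ x, 0 ≤ x → x ≤ v x ∧ v x ≤ x + bbar ν β) ∧ (∀ x, x < 0 → v x = 0)
    ∧ MonotoneOn v (Ici 0) ∧ ContinuousOn v (Ici 0)

/-- A decision rule. -/
def DecisionRule (α : ℝ → ℝ) : Prop :=
  Measurable α ∧ (∀ x, 0 ≤ x → α x ∈ Icc 0 x) ∧ (∀ x, x < 0 → α x = 0)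

/-- The operator `L_α` associated with a decision rule `α`. -/
def Ldiv (ν : Measure ℝ) (β γ : ℝ) (α : ℝ → ℝ) (v : ℝ → ℝ) (x : ℝ) : ℝ :=
  if 0 ≤ x then
    α x - (β / γ) * Real.log
      ((∫ z in Ici (α x - x), Real.exp (-(γ * v (x - α x + z))) ∂ν)
        + (ν (Iio (α x - x))).toReal)
  else 0

/-- The function `Γ` associated with a value function `J`. -/
def Gam (ν : Measure ℝ) (β γ : ℝ) (J : ℝ → ℝ) (x : ℝ) : ℝ :=
  -(β / γ) * Real.log
    ((∫ z in Ici (-x), Real.exp (-(γ * J (x + z))) ∂ν) + (ν (Iio (-x))).toReal)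

end

/-- Measurable functions that vanish on `(-∞, 0)` and satisfy `0 ≤ v x ≤ x + b̄` for `x ≥ 0`. -/
structure IsAdmissibleValue (ν : Measure ℝ) (β : ℝ) (v : ℝ → ℝ) : Prop where
  measurable : Measurable v
  nonneg : ∀ x, 0 ≤ v x
  eq_zero : ∀ x, x < 0 → v x = 0
  le : ∀ x, 0 ≤ x → v x ≤ x + bbar ν β

lemma bbar_nonneg (ν : Measure ℝ) {β : ℝ} (hβ : β ∈ Ioo (0 : ℝ) 1) : 0 ≤ bbar ν β := by
  have h : 0 ≤ ∫ z, max z 0 ∂ν := integral_nonneg fun z => le_max_right _ _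
  exact div_nonneg (mul_nonneg hβ.1.le h) (sub_nonneg.2 hβ.2.le)

lemma bbar_fixed (ν : Measure ℝ) {β : ℝ} (hβ : β ∈ Ioo (0 : ℝ) 1) :
    β * (bbar ν β + ∫ z, max z 0 ∂ν) = bbar ν β := by
  have h : 1 - β ≠ 0 := (sub_pos.2 hβ.2).ne'
  unfold bbar
  field_simp
  ring

lemma isAdmissibleValue_zero (ν : Measure ℝ) {β : ℝ} (hβ : β ∈ Ioo (0 : ℝ) 1) :
    IsAdmissibleValue ν β fun _ => 0 :=
  ⟨measurable_const, fun _ => le_rfl, fun _ _ => rfl,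
    fun _ hx => add_nonneg hx (bbar_nonneg ν hβ)⟩

namespace IsAdmissibleValue

variable {ν : Measure ℝ} {β γ : ℝ} {v w : ℝ → ℝ} {α : ℝ → ℝ}

lemma le_add_max (hv : IsAdmissibleValue ν β v) (hβ : β ∈ Ioo (0 : ℝ) 1) {y : ℝ} (hy : 0 ≤ y)
    (z : ℝ) : v (y + z) ≤ y + bbar ν β + max z 0 := by
  have hb := bbar_nonneg ν hβ
  rcases lt_or_ge (y + z) 0 with h | h
  · rw [hv.eq_zero _ h]
    positivity
  · linarith [hv.le _ h, le_max_left z 0]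

lemma of_tendsto {u : ℕ → ℝ → ℝ} (hu : ∀ n, IsAdmissibleValue ν β (u n))
    (h : ∀ x, Tendsto (fun n => u n x) atTop (𝓝 (v x))) : IsAdmissibleValue ν β v where
  measurable := measurable_of_tendsto_metrizable (fun n => (hu n).measurable)
    (tendsto_pi_nhds.2 h)
  nonneg x := ge_of_tendsto' (h x) fun n => (hu n).nonneg x
  eq_zero x hx := tendsto_nhds_unique (h x) (by simp [(hu _).eq_zero x hx])
  le x hx := le_of_tendsto' (h x) fun n => (hu n).le x hx

variable [IsProbabilityMeasure ν]

lemma integrable_exp (hv : IsAdmissibleValue ν β v) (hγ : 0 < γ) (y : ℝ) :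
    Integrable (fun z => Real.exp (-(γ * v (y + z)))) ν := by
  have hm := hv.measurable
  refine Integrable.of_bound (C := 1)
    (Measurable.aestronglyMeasurable (by fun_prop)) (ae_of_all _ fun z => ?_)
  rw [Real.norm_eq_abs, Real.abs_exp, Real.exp_le_one_iff]
  have := mul_nonneg hγ.le (hv.nonneg (y + z))
  linarith

lemma integral_exp_pos (hv : IsAdmissibleValue ν β v) (hγ : 0 < γ) (y : ℝ) :
    0 < ∫ z, Real.exp (-(γ * v (y + z))) ∂ν :=
  MeasureTheory.integral_exp_pos (hv.integrable_exp hγ y)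

lemma integral_exp_le_one (hv : IsAdmissibleValue ν β v) (hγ : 0 < γ) (y : ℝ) :
    ∫ z, Real.exp (-(γ * v (y + z))) ∂ν ≤ 1 := by
  have h := integral_mono (hv.integrable_exp hγ y) (integrable_const (1 : ℝ)) fun z => by
    have := mul_nonneg hγ.le (hv.nonneg (y + z))
    exact Real.exp_le_one_iff.2 (by linarith)
  simpa using h

/-- Jensen's inequality for the entropic certainty equivalent. -/
lemma le_log_integral_exp (hv : IsAdmissibleValue ν β v)
    (hint : Integrable (fun z => max z 0) ν) (hβ : β ∈ Ioo (0 : ℝ) 1) (hγ : 0 < γ)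
    {y : ℝ} (hy : 0 ≤ y) :
    -(γ * (y + bbar ν β + ∫ z, max z 0 ∂ν)) ≤
      Real.log (∫ z, Real.exp (-(γ * v (y + z))) ∂ν) := by
  rw [Real.le_log_iff_exp_le (hv.integral_exp_pos hγ y)]
  set M := ∫ z, max z 0 ∂ν with hM
  set E := Real.exp (-(γ * (y + bbar ν β + M))) with hE
  have hi : Integrable (fun z => E * (1 + γ * M - γ * max z 0)) ν :=
    ((integrable_const _).sub (hint.const_mul γ)).const_mul E
  have hval : ∫ z, E * (1 + γ * M - γ * max z 0) ∂ν = E := by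
    rw [integral_const_mul, integral_sub (integrable_const _) (hint.const_mul γ),
      integral_const_mul]
    simp [← hM]
  rw [← hval]
  refine integral_mono hi (hv.integrable_exp hγ y) fun z => ?_
  have h1 := Real.add_one_le_exp (γ * M - γ * max z 0)
  have h2 := mul_le_mul_of_nonneg_left (hv.le_add_max hβ hy z) hγ.le
  calc E * (1 + γ * M - γ * max z 0) ≤ E * Real.exp (γ * M - γ * max z 0) :=
        mul_le_mul_of_nonneg_left (by linarith) (Real.exp_pos _).le
    _ = Real.exp (-(γ * (y + bbar ν β + max z 0))) := by
        rw [hE, ← Real.exp_add]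
        ring_nf
    _ ≤ Real.exp (-(γ * v (y + z))) := Real.exp_le_exp.2 (by linarith)

lemma Ldiv_eq (hv : IsAdmissibleValue ν β v) (hγ : 0 < γ) {x : ℝ} (hx : 0 ≤ x) :
    Ldiv ν β γ α v x =
      α x - (β / γ) * Real.log (∫ z, Real.exp (-(γ * v (x - α x + z))) ∂ν) := by
  have h : ∫ z in Iio (α x - x), Real.exp (-(γ * v (x - α x + z))) ∂ν
      = (ν (Iio (α x - x))).toReal := by
    rw [setIntegral_congr_fun (g := fun _ => (1 : ℝ)) measurableSet_Iio]
    · simp [Measure.real]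
    · intro z hz
      have hz' : x - α x + z < 0 := by
        have : z < α x - x := hz
        linarith
      simp [hv.eq_zero _ hz']
  rw [Ldiv, if_pos hx, ← h, ← integral_add_compl measurableSet_Ici (hv.integrable_exp hγ _),
    compl_Ici]

lemma Ldiv_mono (hv : IsAdmissibleValue ν β v) (hw : IsAdmissibleValue ν β w)
    (hβ : 0 < β) (hγ : 0 < γ) (hvw : v ≤ w) :
    Ldiv ν β γ α v ≤ Ldiv ν β γ α w := by
  intro x
  rcases lt_or_ge x 0 with hx | hx
  · simp [Ldiv, hx.not_ge]
  rw [hv.Ldiv_eq hγ hx, hw.Ldiv_eq hγ hx]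
  refine sub_le_sub_left (mul_le_mul_of_nonneg_left ?_ (div_pos hβ hγ).le) _
  refine Real.log_le_log (hw.integral_exp_pos hγ _) ?_
  refine integral_mono (hw.integrable_exp hγ _) (hv.integrable_exp hγ _) fun z => ?_
  exact Real.exp_le_exp.2 (neg_le_neg (mul_le_mul_of_nonneg_left (hvw _) hγ.le))

lemma Ldiv_nonneg (hv : IsAdmissibleValue ν β v) (hβ : 0 < β) (hγ : 0 < γ)
    (hα : DecisionRule α) (x : ℝ) : 0 ≤ Ldiv ν β γ α v x := by
  rcases lt_or_ge x 0 with hx | hx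
  · simp [Ldiv, hx.not_ge]
  rw [hv.Ldiv_eq hγ hx]
  have h := Real.log_nonpos (hv.integral_exp_pos hγ (x - α x)).le (hv.integral_exp_le_one hγ _)
  have := mul_nonpos_of_nonneg_of_nonpos (div_pos hβ hγ).le h
  linarith [(hα.2.1 x hx).1]

lemma Ldiv_le (hv : IsAdmissibleValue ν β v) (hint : Integrable (fun z => max z 0) ν)
    (hβ : β ∈ Ioo (0 : ℝ) 1) (hγ : 0 < γ) (hα : DecisionRule α) {x : ℝ} (hx : 0 ≤ x) :
    Ldiv ν β γ α v x ≤ x + bbar ν β := by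
  rw [hv.Ldiv_eq hγ hx]
  have hy : 0 ≤ x - α x := sub_nonneg.2 (hα.2.1 x hx).2
  have h := mul_le_mul_of_nonneg_left (hv.le_log_integral_exp hint hβ hγ hy)
    (div_pos hβ.1 hγ).le
  have hγ' : β / γ * -(γ * (x - α x + bbar ν β + ∫ z, max z 0 ∂ν))
      = -(β * (x - α x) + β * (bbar ν β + ∫ z, max z 0 ∂ν)) := by
    field_simp
    ring
  rw [hγ', bbar_fixed ν hβ] at h
  linarith [mul_le_of_le_one_left hy hβ.2.le]

lemma measurable_Ldiv (hv : IsAdmissibleValue ν β v) (hγ : 0 < γ) (hα : DecisionRule α) :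
    Measurable (Ldiv ν β γ α v) := by
  have hm := hv.measurable
  have hmα := hα.1
  have hI : Measurable fun x => ∫ z, Real.exp (-(γ * v (x - α x + z))) ∂ν := by
    refine (StronglyMeasurable.integral_prod_right
      (f := fun x z => Real.exp (-(γ * v (x - α x + z)))) ?_).measurable
    refine Measurable.stronglyMeasurable ?_
    simp only [Function.uncurry_def]
    fun_prop
  have heq : Ldiv ν β γ α v = (Ici 0).indicator fun x =>
      α x - (β / γ) * Real.log (∫ z, Real.exp (-(γ * v (x - α x + z))) ∂ν) := by
    funext x
    rcases lt_or_ge x 0 with hx | hx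
    · simp [Ldiv, hx.not_ge]
    · rw [indicator_of_mem (mem_Ici.2 hx), hv.Ldiv_eq hγ hx]
  rw [heq]
  exact (hmα.sub (hI.log.const_mul _)).indicator measurableSet_Ici

lemma map_Ldiv (hv : IsAdmissibleValue ν β v) (hint : Integrable (fun z => max z 0) ν)
    (hβ : β ∈ Ioo (0 : ℝ) 1) (hγ : 0 < γ) (hα : DecisionRule α) :
    IsAdmissibleValue ν β (Ldiv ν β γ α v) where
  measurable := hv.measurable_Ldiv hγ hα
  nonneg := hv.Ldiv_nonneg hβ.1 hγ hα
  eq_zero x hx := by simp [Ldiv, hx.not_ge]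
  le _ hx := hv.Ldiv_le hint hβ hγ hα hx

lemma tendsto_Ldiv {u : ℕ → ℝ → ℝ} (hu : ∀ n, IsAdmissibleValue ν β (u n))
    (h : ∀ x, Tendsto (fun n => u n x) atTop (𝓝 (v x))) (hγ : 0 < γ) (x : ℝ) :
    Tendsto (fun n => Ldiv ν β γ α (u n) x) atTop (𝓝 (Ldiv ν β γ α v x)) := by
  have hv := of_tendsto hu h
  rcases lt_or_ge x 0 with hx | hx
  · simp [Ldiv, hx.not_ge]
  simp_rw [(hu _).Ldiv_eq hγ hx]
  rw [hv.Ldiv_eq hγ hx]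
  refine tendsto_const_nhds.sub (Tendsto.const_mul _
    (Tendsto.log ?_ (hv.integral_exp_pos hγ _).ne'))
  refine tendsto_integral_of_dominated_convergence (fun _ => 1)
    (fun n => ((hu n).integrable_exp hγ _).aestronglyMeasurable) (integrable_const _) ?_ ?_
  · intro n
    refine ae_of_all _ fun z => ?_
    rw [Real.norm_eq_abs, Real.abs_exp, Real.exp_le_one_iff]
    have := mul_nonneg hγ.le ((hu n).nonneg (x - α x + z))
    linarith
  · exact ae_of_all _ fun z => ((h _).const_mul γ).neg.rexp

lemma iterate_Ldiv (hint : Integrable (fun z => max z 0) ν) (hβ : β ∈ Ioo (0 : ℝ) 1)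
    (hγ : 0 < γ) (hα : DecisionRule α) (n : ℕ) :
    IsAdmissibleValue ν β ((Ldiv ν β γ α)^[n] fun _ => 0) := by
  induction n with
  | zero => exact isAdmissibleValue_zero ν hβ
  | succ n ih =>
    rw [Function.iterate_succ_apply']
    exact ih.map_Ldiv hint hβ hγ hα

end IsAdmissibleValue

/-- for every decision rule `α`, the iterates `L_αⁿ 0` are pointwise
nondecreasing and bounded, the pointwise limit `J_α` exists, and `L_α J_α = J_α`. -/
theorem stationary_value_exists (ν : Measure ℝ) [IsProbabilityMeasure ν]
    (hac : ν ≪ volume) (hint : Integrable (fun z => max z 0) ν)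
    (hneg : 0 < ν (Iio 0)) (β γ : ℝ) (hβ : β ∈ Ioo (0:ℝ) 1) (hγ : 0 < γ)
    (α : ℝ → ℝ) (hα : DecisionRule α) :
    (∀ n : ℕ, ∀ x : ℝ, (Ldiv ν β γ α)^[n] (fun _ => 0) x ≤
        (Ldiv ν β γ α)^[n + 1] (fun _ => 0) x) ∧
    (∀ n : ℕ, ∀ x : ℝ, 0 ≤ x → 0 ≤ (Ldiv ν β γ α)^[n] (fun _ => 0) x ∧
        (Ldiv ν β γ α)^[n] (fun _ => 0) x ≤ x + bbar ν β) ∧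
    (∃ Jα : ℝ → ℝ,
      (∀ x : ℝ, Tendsto (fun n => (Ldiv ν β γ α)^[n] (fun _ => 0) x) atTop (𝓝 (Jα x))) ∧
      Ldiv ν β γ α Jα = Jα) := by
  have hadm := IsAdmissibleValue.iterate_Ldiv (α := α) hint hβ hγ hα
  have hmono : ∀ n : ℕ, (Ldiv ν β γ α)^[n] (fun _ => 0) ≤
      (Ldiv ν β γ α)^[n + 1] (fun _ => 0) := by
    intro n
    induction n with
    | zero => exact (hadm 1).nonneg
    | succ n ih =>
      have h := (hadm n).Ldiv_mono (α := α) (hadm (n + 1)) hβ.1 hγ ih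
      rwa [← Function.iterate_succ_apply' (Ldiv ν β γ α),
        ← Function.iterate_succ_apply' (Ldiv ν β γ α)] at h
  refine ⟨hmono, fun n x hx => ⟨(hadm n).nonneg x, (hadm n).le x hx⟩, ?_⟩
  have hlim : ∀ x, ∃ l, Tendsto (fun n => (Ldiv ν β γ α)^[n] (fun _ => 0) x) atTop (𝓝 l) := by
    intro x
    refine ⟨_, tendsto_atTop_ciSup (monotone_nat_of_le_succ fun n => hmono n x)
      ⟨|x| + bbar ν β, ?_⟩⟩
    rintro _ ⟨n, rfl⟩
    simpa using
      ((hadm n).le_add_max hβ (abs_nonneg x) (x - |x|)).trans_eq (by simp [le_abs_self])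
  choose J hJ using hlim
  refine ⟨J, hJ, funext fun x => ?_⟩
  refine tendsto_nhds_unique (IsAdmissibleValue.tendsto_Ldiv hadm hJ hγ x) ?_
  simpa only [Function.comp_def, Function.iterate_succ_apply'] using (hJ x).comp (tendsto_add_atTop_nat 1)
end

section
/- Let α be a decision rule such that L_α J = J and α(x) ≥ max(x − c, 0) for all x ≥ 0, for some constant c ≥ 0. Then the pointwise limit J_α(x) := lim_{n→∞} L_αⁿ 0(x) equals J(x) for every x ≥ 0; that is, the stationary policy α is optimal. -/
open MeasureTheory Set Filter Topology

/-- Measurable nonnegative functions vanishing on the negative half-line. -/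
def AdmissibleValue (v : ℝ → ℝ) : Prop :=
  Measurable v ∧ (∀ x, 0 ≤ v x) ∧ ∀ x, x < 0 → v x = 0

theorem AdmissibleValue.integrable_exp {ν : Measure ℝ} [IsProbabilityMeasure ν] {γ : ℝ}
    (hγ : 0 < γ) {v : ℝ → ℝ} (hv : AdmissibleValue v) (y : ℝ) :
    Integrable (fun z => Real.exp (-(γ * v (y + z)))) ν := by
  have hm : Measurable (fun z => Real.exp (-(γ * v (y + z)))) :=
    ((hv.1.comp (measurable_const_add y)).const_mul γ).neg.exp
  refine Integrable.of_bound hm.aestronglyMeasurable 1 (ae_of_all _ fun z => ?_)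
  rw [Real.norm_eq_abs, Real.abs_exp, Real.exp_le_one_iff]
  have := mul_nonneg hγ.le (hv.2.1 (y + z))
  linarith

theorem Ldiv_eq_log_integral {ν : Measure ℝ} [IsProbabilityMeasure ν] {β γ : ℝ} (hγ : 0 < γ)
    {v : ℝ → ℝ} (hv : AdmissibleValue v) (α : ℝ → ℝ) {x : ℝ} (hx : 0 ≤ x) :
    Ldiv ν β γ α v x
      = α x - (β / γ) * Real.log (∫ z, Real.exp (-(γ * v (x - α x + z))) ∂ν) := by
  have hneg : ∫ z in Iio (α x - x), Real.exp (-(γ * v (x - α x + z))) ∂ν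
      = (ν (Iio (α x - x))).toReal := by
    rw [setIntegral_congr_fun (g := fun _ => (1 : ℝ)) measurableSet_Iio]
    · simp [Measure.real]
    · intro z hz
      have hz' : z < α x - x := hz
      have h0 : v (x - α x + z) = 0 := hv.2.2 _ (by linarith)
      simp [h0]
  rw [Ldiv, if_pos hx, ← hneg, ← compl_Ici,
    integral_add_compl measurableSet_Ici (hv.integrable_exp hγ _)]

theorem le_Ldiv {ν : Measure ℝ} [IsProbabilityMeasure ν] {β γ : ℝ} (hβ : 0 ≤ β) (hγ : 0 < γ)
    {v : ℝ → ℝ} (hv : AdmissibleValue v) (α : ℝ → ℝ) {x : ℝ} (hx : 0 ≤ x) :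
    α x ≤ Ldiv ν β γ α v x := by
  rw [Ldiv_eq_log_integral hγ hv α hx]
  have hle : ∫ z, Real.exp (-(γ * v (x - α x + z))) ∂ν ≤ 1 := by
    calc ∫ z, Real.exp (-(γ * v (x - α x + z))) ∂ν ≤ ∫ _, (1 : ℝ) ∂ν := by
          refine integral_mono (hv.integrable_exp hγ _) (integrable_const _) fun z => ?_
          have := mul_nonneg hγ.le (hv.2.1 (x - α x + z))
          exact Real.exp_le_one_iff.2 (by linarith)
      _ = 1 := by simp
  have hlog := Real.log_nonpos (integral_nonneg fun z => (Real.exp_pos _).le) hle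
  have := mul_nonpos_of_nonneg_of_nonpos (div_nonneg hβ hγ.le) hlog
  linarith

theorem AdmissibleValue.ldiv {ν : Measure ℝ} [IsProbabilityMeasure ν] {β γ : ℝ} (hβ : 0 ≤ β)
    (hγ : 0 < γ) {α : ℝ → ℝ} (hα : DecisionRule α) {v : ℝ → ℝ} (hv : AdmissibleValue v) :
    AdmissibleValue (Ldiv ν β γ α v) := by
  refine ⟨?_, fun x => ?_, fun x hx => if_neg (not_le.2 hx)⟩
  · have hjoint : Measurable
        (fun p : ℝ × ℝ => Real.exp (-(γ * v (p.1 - α p.1 + p.2)))) := by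
      have hα' : Measurable fun p : ℝ × ℝ => α p.1 := hα.1.comp measurable_fst
      exact ((hv.1.comp ((measurable_fst.sub hα').add measurable_snd)).const_mul γ).neg.exp
    have hmeas : Measurable fun x => ∫ z, Real.exp (-(γ * v (x - α x + z))) ∂ν :=
      hjoint.stronglyMeasurable.integral_prod_right.measurable
    have heq : Ldiv ν β γ α v = fun x => if 0 ≤ x then
        α x - (β / γ) * Real.log (∫ z, Real.exp (-(γ * v (x - α x + z))) ∂ν) else 0 := by
      funext x
      split_ifs with hx
      · exact Ldiv_eq_log_integral hγ hv α hx
      · exact if_neg hx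
    rw [heq]
    exact Measurable.ite measurableSet_Ici (hα.1.sub (hmeas.log.const_mul _)) measurable_const
  · rcases le_or_gt 0 x with hx | hx
    · exact (hα.2.1 x hx).1.trans (le_Ldiv hβ hγ hv α hx)
    · exact (if_neg (not_le.2 hx)).ge

theorem Ldiv_le_Ldiv_add {ν : Measure ℝ} [IsProbabilityMeasure ν] {β γ : ℝ} (hβ : 0 ≤ β)
    (hγ : 0 < γ) (α : ℝ → ℝ) {v w : ℝ → ℝ} (hv : AdmissibleValue v) (hw : AdmissibleValue w)
    {k : ℝ} (hk : 0 ≤ k) (h : ∀ x, v x ≤ w x + k) (x : ℝ) :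
    Ldiv ν β γ α v x ≤ Ldiv ν β γ α w x + β * k := by
  rcases le_or_gt 0 x with hx | hx
  · rw [Ldiv_eq_log_integral hγ hv α hx, Ldiv_eq_log_integral hγ hw α hx]
    set A := ∫ z, Real.exp (-(γ * v (x - α x + z))) ∂ν with hA
    set B := ∫ z, Real.exp (-(γ * w (x - α x + z))) ∂ν with hB
    have hBpos : 0 < B := integral_exp_pos (hw.integrable_exp hγ _)
    have hAB : Real.exp (-(γ * k)) * B ≤ A := by
      rw [hA, hB, ← integral_const_mul]
      refine integral_mono ((hw.integrable_exp hγ _).const_mul _) (hv.integrable_exp hγ _)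
        fun z => ?_
      simp only [← Real.exp_add]
      refine Real.exp_le_exp.2 ?_
      have := mul_le_mul_of_nonneg_left (h (x - α x + z)) hγ.le
      linarith
    have hlog := Real.log_le_log (mul_pos (Real.exp_pos _) hBpos) hAB
    rw [Real.log_mul (Real.exp_pos _).ne' hBpos.ne', Real.log_exp] at hlog
    have hmul := mul_le_mul_of_nonneg_left hlog (div_nonneg hβ hγ.le)
    have hcancel : β / γ * (-(γ * k) + Real.log B) = -(β * k) + β / γ * Real.log B := by
      field_simp
    linarith
  · simp only [Ldiv, if_neg (not_le.2 hx), zero_add]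
    exact mul_nonneg hβ hk

theorem memS.admissibleValue {ν : Measure ℝ} {β : ℝ} {v : ℝ → ℝ} (hv : memS ν β v) :
    AdmissibleValue v := by
  obtain ⟨hnonneg, -, hzero, -, hcont⟩ := hv
  refine ⟨?_, hnonneg, hzero⟩
  have heq : v = (Ici 0).piecewise v 0 := by
    funext x
    by_cases hx : x ∈ Ici (0 : ℝ)
    · rw [piecewise_eq_of_mem _ _ _ hx]
    · rw [piecewise_eq_of_notMem _ _ _ hx]
      exact hzero x (not_le.1 hx)
  rw [heq]
  exact hcont.measurable_piecewise continuousOn_const measurableSet_Ici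

/-- if the decision rule `α` satisfies `L_α J = J` and
`α(x) ≥ max(x - c, 0)` for some `c ≥ 0`, then the stationary policy `α` is
optimal: its value `J_α = lim L_αⁿ 0` equals `J` on `[0,∞)`. -/
theorem stationary_policy_optimal (ν : Measure ℝ) [IsProbabilityMeasure ν]
    (hac : ν ≪ volume) (hint : Integrable (fun z => max z 0) ν)
    (hneg : 0 < ν (Iio 0)) (β γ : ℝ) (hβ : β ∈ Ioo (0:ℝ) 1) (hγ : 0 < γ)
    (J : ℝ → ℝ) (hJ : memS ν β J) (hfix : Tdiv ν β γ J = J)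
    (α : ℝ → ℝ) (hα : DecisionRule α) (hLfix : Ldiv ν β γ α J = J)
    (c : ℝ) (hc : 0 ≤ c) (hαc : ∀ x : ℝ, 0 ≤ x → max (x - c) 0 ≤ α x) :
    ∀ x : ℝ, 0 ≤ x →
      Tendsto (fun n => (Ldiv ν β γ α)^[n] (fun _ => 0) x) atTop (𝓝 (J x)) := by
  have hβ0 : 0 ≤ β := hβ.1.le
  have hJadm := hJ.admissibleValue
  have hadm : ∀ n, AdmissibleValue ((Ldiv ν β γ α)^[n] (fun _ => 0)) := by
    intro n
    induction n with
    | zero => exact ⟨measurable_const, fun _ => le_rfl, fun _ _ => rfl⟩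
    | succ n ih =>
      rw [Function.iterate_succ_apply']
      exact ih.ldiv hβ0 hγ hα
  have hupper : ∀ n x, (Ldiv ν β γ α)^[n] (fun _ => 0) x ≤ J x := by
    intro n
    induction n with
    | zero => exact hJ.1
    | succ n ih =>
      intro x
      rw [Function.iterate_succ_apply']
      have h := Ldiv_le_Ldiv_add (ν := ν) hβ0 hγ α (hadm n) hJadm le_rfl
        (fun x => (ih x).trans (by simp)) x
      rwa [hLfix, mul_zero, add_zero] at h
  have hK : 0 ≤ c + bbar ν β := by
    have := hJ.2.1 0 le_rfl
    linarith
  have hlower : ∀ n x, J x ≤ (Ldiv ν β γ α)^[n + 1] (fun _ => 0) x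
      + β ^ n * (c + bbar ν β) := by
    intro n
    induction n with
    | zero =>
      intro x
      rw [Function.iterate_succ_apply', pow_zero, one_mul]
      rcases le_or_gt 0 x with hx | hx
      · have h1 := le_Ldiv (ν := ν) hβ0 hγ (hadm 0) α hx
        have h2 := (le_max_left _ _).trans (hαc x hx)
        have h3 := (hJ.2.1 x hx).2
        linarith
      · rw [hJ.2.2.1 x hx]
        exact add_nonneg (((hadm 0).ldiv hβ0 hγ hα).2.1 x) hK
    | succ n ih =>
      intro x
      rw [Function.iterate_succ_apply']
      have h := Ldiv_le_Ldiv_add (ν := ν) hβ0 hγ α hJadm (hadm (n + 1))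
        (mul_nonneg (pow_nonneg hβ0 n) hK) ih x
      rwa [hLfix, ← mul_assoc, ← pow_succ'] at h
  intro x _
  rw [← tendsto_add_atTop_iff_nat 1]
  have hpow : Tendsto (fun n : ℕ => J x - β ^ n * (c + bbar ν β)) atTop (𝓝 (J x)) := by
    simpa using ((tendsto_pow_atTop_nhds_zero_of_lt_one hβ0 hβ.2).mul_const
      (c + bbar ν β)).const_sub (J x)
  exact tendsto_of_tendsto_of_tendsto_of_le_of_le hpow tendsto_const_nhds
    (fun n => sub_le_iff_le_add.2 (hlower n x)) (fun n => hupper (n + 1) x)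
end
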